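/- Let P and Q be positive joint distributions on 𝒳 × 𝒴. Define E₀(P‖Q) = sup{ liminf_{n→∞} −(1/n)·log β[T_n] }, where the supremum is over all zero-rate sequences of testing schemes (T_n) with lim_{n→∞} α[T_n] = 0, and define E_s(P‖Q) analogously with the supremum over all symmetric sequences of testing schemes (T_n) with lim_{n→∞} α[T_n] = 0. Then E₀(P‖Q) = E_s(P‖Q) = E(P‖Q). -/

import Mathlib

open scoped Classical BigOperators

noncomputable section

variable {X Y : Type*} [Fintype X] [Fintype Y]

/-- `P` is a joint distribution on `X × Y`. -/
def IsDist (P : X × Y → ℝ) : Prop :=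
  (∀ z, 0 ≤ P z) ∧ ∑ z : X × Y, P z = 1

/-- `P` is a positive joint distribution on `X × Y`. -/
def IsPos (P : X × Y → ℝ) : Prop :=
  (∀ z, 0 < P z) ∧ ∑ z : X × Y, P z = 1

/-- The first marginal of a joint distribution. -/
def margX (P : X × Y → ℝ) (x : X) : ℝ := ∑ y : Y, P (x, y)

/-- The second marginal of a joint distribution. -/
def margY (P : X × Y → ℝ) (y : Y) : ℝ := ∑ x : X, P (x, y)

/-- Relative entropy `D(P‖Q)` (natural log; `Real.log 0 = 0` realizes `0·log 0 = 0`). -/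
def relEnt (P Q : X × Y → ℝ) : ℝ := ∑ z : X × Y, P z * Real.log (P z / Q z)

/-- Projected relative entropy `E(P‖Q)`. -/
def projE (P Q : X × Y → ℝ) : ℝ :=
  sInf { d : ℝ | ∃ P' : X × Y → ℝ,
    IsDist P' ∧ margX P' = margX P ∧ margY P' = margY P ∧ d = relEnt P' Q }

/-- `R ∈ ℰ^{xy}(S)` : `R` has the same correlation coordinates as `S`. -/
def SameCorr (R S : X × Y → ℝ) : Prop :=
  ∃ a1 : X → ℝ, ∃ a2 : Y → ℝ,
    ∀ x : X, ∀ y : Y, Real.log (R (x, y) / S (x, y)) = a1 x + a2 y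

/-- The type (empirical distribution) of a sequence. -/
def empDist {n : ℕ} (x : Fin n → X) (a : X) : ℝ :=
  ((Finset.univ.filter fun i => x i = a).card : ℝ) / n

/-- The joint type of a pair of sequences. -/
def empJoint {n : ℕ} (x : Fin n → X) (y : Fin n → Y) (z : X × Y) : ℝ :=
  ((Finset.univ.filter fun i => x i = z.1 ∧ y i = z.2).card : ℝ) / n

/-- Probability of a set under the `n`-fold i.i.d. product of `P`. -/
def prodProb (P : X × Y → ℝ) (n : ℕ) (A : Set ((Fin n → X) × (Fin n → Y))) : ℝ :=
  ∑ z : (Fin n → X) × (Fin n → Y),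
    if z ∈ A then ∏ i : Fin n, P (z.1 i, z.2 i) else 0

/-- `P` is a joint type with denominator `n` (an element of `𝒫ₙ(𝒳 × 𝒴)`). -/
def IsTypeN (n : ℕ) (P : X × Y → ℝ) : Prop :=
  IsDist P ∧ ∀ z : X × Y, ∃ k : ℕ, P z = (k : ℝ) / n

/-- `Eₙ(P̄‖Q)` : projected relative entropy restricted to joint types. -/
def En (n : ℕ) (Pbar Q : X × Y → ℝ) : ℝ :=
  sInf { d : ℝ | ∃ Pt : X × Y → ℝ,
    IsTypeN n Pt ∧ margX Pt = margX Pbar ∧ margY Pt = margY Pbar ∧ d = relEnt Pt Q }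

/-- Standard normal cumulative distribution function `Φ`. -/
def stdNormalCDF (t : ℝ) : ℝ :=
  ∫ u in Set.Iic t, (Real.sqrt (2 * Real.pi))⁻¹ * Real.exp (-(u ^ 2) / 2)

/-- Inverse of the standard normal CDF, `Φ⁻¹`. -/
def stdNormalCDFInv (e : ℝ) : ℝ := Function.invFun stdNormalCDF e

/-- A multiterminal testing scheme at blocklength `n`: two encoders into finite
message sets and a decoder (`true` = accept `H₀`). -/
structure Scheme (X Y : Type*) (n : ℕ) where
  m1 : ℕ
  m2 : ℕ
  f1 : (Fin n → X) → Fin m1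
  f2 : (Fin n → Y) → Fin m2
  g : Fin m1 → Fin m2 → Bool

/-- Type I error probability of a testing scheme. -/
def alphaErr (P : X × Y → ℝ) {n : ℕ} (T : Scheme X Y n) : ℝ :=
  prodProb P n {z : (Fin n → X) × (Fin n → Y) | T.g (T.f1 z.1) (T.f2 z.2) = false}

/-- Type II error probability of a testing scheme. -/
def betaErr (Q : X × Y → ℝ) {n : ℕ} (T : Scheme X Y n) : ℝ :=
  prodProb Q n {z : (Fin n → X) × (Fin n → Y) | T.g (T.f1 z.1) (T.f2 z.2) = true}

/-- A sequence of schemes is zero-rate. -/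
def ZeroRate (T : (n : ℕ) → Scheme X Y n) : Prop :=
  Filter.Tendsto (fun n : ℕ => Real.log ((T n).m1 : ℝ) / (n : ℝ)) Filter.atTop (nhds 0) ∧
  Filter.Tendsto (fun n : ℕ => Real.log ((T n).m2 : ℝ) / (n : ℝ)) Filter.atTop (nhds 0)

/-- A sequence of schemes is symmetric: encoders depend only on the types. -/
def SymScheme (T : (n : ℕ) → Scheme X Y n) : Prop :=
  ∀ n : ℕ,
    (∀ x x' : Fin n → X, empDist x = empDist x' → (T n).f1 x = (T n).f1 x') ∧
    (∀ y y' : Fin n → Y, empDist y = empDist y' → (T n).f2 y = (T n).f2 y')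

open Filter Topology

section Scaling

lemma mul_abs_sub_le_mul_exp_sub {p q : ℝ} (hp : 0 < p) (hq : 0 < q) (t : ℝ) :
    p * |t| - 2 * p ^ 2 / q ≤ q * Real.exp t - p * t := by
  have hC : 0 ≤ 2 * p ^ 2 / q := by positivity
  rcases le_total t 0 with ht | ht
  · rw [abs_of_nonpos ht]
    have := mul_pos hq (Real.exp_pos t)
    linarith
  · rw [abs_of_nonneg ht]
    have h1 := mul_le_mul_of_nonneg_left (Real.quadratic_le_exp_of_nonneg ht) hq.le
    have h2 : 0 ≤ q / 2 * (t - 2 * p / q) ^ 2 := by positivity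
    have h3 : q / 2 * (t - 2 * p / q) ^ 2 = q * t ^ 2 / 2 - 2 * p * t + 2 * p ^ 2 / q := by
      field_simp
      ring
    nlinarith [mul_nonneg hq.le ht]

/-- Two positive distributions: the second can be rescaled by a product of functions of each
coordinate so as to have the marginals of the first. -/
lemma exists_scaling_marginals [Nonempty X] [Nonempty Y] (P Q : X × Y → ℝ)
    (hP : ∀ z, 0 < P z) (hQ : ∀ z, 0 < Q z) :
    ∃ a : X → ℝ, ∃ b : Y → ℝ,
      margX (fun z => Q z * Real.exp (a z.1 + b z.2)) = margX P ∧
      margY (fun z => Q z * Real.exp (a z.1 + b z.2)) = margY P := by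
  obtain ⟨x0⟩ := ‹Nonempty X›
  obtain ⟨y0⟩ := ‹Nonempty Y›
  let H : Set (X × Y → ℝ) := {h | ∀ x y, h (x, y) + h (x0, y0) = h (x, y0) + h (x0, y)}
  let F : (X × Y → ℝ) → ℝ := fun h => ∑ z, (Q z * Real.exp (h z) - P z * h z)
  have hF : Continuous F := by fun_prop
  have hH : IsClosed H := by
    simp only [H, Set.ofPred_forall]
    refine isClosed_iInter fun x => isClosed_iInter fun y => isClosed_eq ?_ ?_ <;> fun_prop
  set C : ℝ := ∑ z, 2 * P z ^ 2 / Q z with hC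
  let R : X × Y → ℝ := fun z => (F 0 + C) / P z
  have hbound : ∀ h, F h ≤ F 0 → ∀ z, |h z| ≤ R z := by
    intro h hh z
    rw [le_div_iff₀ (hP z)]
    have h1 : ∑ w, (P w * |h w| - 2 * P w ^ 2 / Q w) ≤ F h :=
      Finset.sum_le_sum fun w _ => mul_abs_sub_le_mul_exp_sub (hP w) (hQ w) (h w)
    rw [Finset.sum_sub_distrib] at h1
    have h2 : P z * |h z| ≤ ∑ w, P w * |h w| :=
      Finset.single_le_sum (f := fun w => P w * |h w|)
        (fun w _ => mul_nonneg (hP w).le (abs_nonneg _)) (Finset.mem_univ z)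
    linarith
  have hK : IsCompact (H ∩ Set.pi Set.univ fun z => Set.Icc (-R z) (R z)) :=
    (isCompact_univ_pi fun z => isCompact_Icc).inter_left hH
  have h0 : (0 : X × Y → ℝ) ∈ H ∩ Set.pi Set.univ fun z => Set.Icc (-R z) (R z) :=
    ⟨fun x y => by simp, fun z _ => abs_le.mp (hbound 0 le_rfl z)⟩
  obtain ⟨h, hh, hmin⟩ := hK.exists_isMinOn ⟨0, h0⟩ hF.continuousOn
  have hmin' : ∀ k ∈ H, F h ≤ F k := by
    intro k hk
    by_cases hk0 : F k ≤ F 0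
    · exact hmin ⟨hk, fun z _ => abs_le.mp (hbound k hk0 z)⟩
    · exact (hmin h0).trans (le_of_not_ge hk0)
  have hgrad : ∀ k ∈ H, ∑ z, Q z * Real.exp (h z) * k z = ∑ z, P z * k z := by
    intro k hk
    have hd : HasDerivAt (fun t : ℝ => F (fun z => h z + t * k z))
        (∑ z, (Q z * (Real.exp (h z + 0 * k z) * (1 * k z)) - P z * (1 * k z))) 0 := by
      refine HasDerivAt.fun_sum fun z _ => ?_
      have hl : HasDerivAt (fun t : ℝ => h z + t * k z) (1 * k z) 0 :=
        ((hasDerivAt_id' (0 : ℝ)).mul_const (k z)).const_add (h z)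
      exact (hl.exp.const_mul (Q z)).sub (hl.const_mul (P z))
    have hm : IsLocalMin (fun t : ℝ => F (fun z => h z + t * k z)) 0 := by
      refine Filter.Eventually.of_forall fun t => ?_
      have : F h ≤ F (fun z => h z + t * k z) := by
        refine hmin' _ fun x y => ?_
        have e1 := hh.1 x y
        have e2 := hk x y
        linear_combination e1 + t * e2
      simpa using this
    have := hm.hasDerivAt_eq_zero hd
    rw [Finset.sum_sub_distrib] at this
    simp only [zero_mul, add_zero, one_mul] at this
    simp only [mul_assoc]
    linarith
  have hexp : ∀ z, h z = (h (z.1, y0) - h (x0, y0)) + h (x0, z.2) := by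
    rintro ⟨x, y⟩
    have := hh.1 x y
    simp only
    linarith
  refine ⟨fun x => h (x, y0) - h (x0, y0), fun y => h (x0, y), ?_, ?_⟩
  · funext c
    have := hgrad (fun z => if z.1 = c then 1 else 0) (fun x y => by simp)
    simp only [← hexp]
    simpa [margX, Fintype.sum_prod_type, Finset.sum_comm (γ := X)] using this
  · funext c
    have := hgrad (fun z => if z.2 = c then 1 else 0) (fun x y => by simp [add_comm])
    simp only [← hexp]
    simpa [margY, Fintype.sum_prod_type] using this

end Scaling

section SingleLetter

/-- Gibbs' variational inequality. -/
lemma exp_sum_mul_log_le {ι : Type*} [Fintype ι] (p W : ι → ℝ) (hp : ∀ i, 0 ≤ p i)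
    (hp1 : ∑ i, p i = 1) (hW : ∀ i, 0 < W i) :
    Real.exp (∑ i, p i * Real.log (W i / p i)) ≤ ∑ i, W i := by
  set t := ∑ i, p i * Real.log (W i / p i) with ht
  have key : ∀ i, Real.exp t * (p i * (1 - t) + p i * Real.log (W i / p i)) ≤ W i := by
    intro i
    rcases (hp i).eq_or_lt with h0 | h0
    · simpa [← h0] using (hW i).le
    · have h1 := Real.add_one_le_exp (Real.log (W i / p i) - t)
      rw [Real.exp_sub, Real.exp_log (div_pos (hW i) h0), div_div, le_div_iff₀ (by positivity)] at h1
      linarith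
  calc Real.exp t = ∑ i, Real.exp t * (p i * (1 - t) + p i * Real.log (W i / p i)) := by
        rw [← Finset.mul_sum, Finset.sum_add_distrib, ← Finset.sum_mul, hp1, ← ht]
        ring
    _ ≤ _ := Finset.sum_le_sum fun i _ => key i

lemma exists_one_le_of_sum_mul_eq_one {ι : Type*} [Fintype ι] (p u : ι → ℝ)
    (hp : ∀ i, 0 ≤ p i) (hp1 : ∑ i, p i = 1) (hu1 : ∑ i, p i * u i = 1) : ∃ i, 1 ≤ u i := by
  by_contra! hlt
  obtain ⟨i, -, hi⟩ : ∃ i ∈ Finset.univ, 0 < p i := by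
    apply Finset.exists_lt_of_sum_lt
    simp [hp1]
  have : ∑ i, p i * u i < ∑ i, p i := by
    refine Finset.sum_lt_sum (fun j _ => ?_) ⟨i, Finset.mem_univ _, ?_⟩
    · nlinarith [hp j, hlt j]
    · nlinarith [hlt i]
  linarith

/-- A function of mean one that nowhere exceeds `1 + η` has expected logarithm at least a
negative multiple of `η ^ 2`. -/
lemma neg_le_sum_mul_log {ι : Type*} [Fintype ι] (p u : ι → ℝ) {π η : ℝ} (hπ : 0 < π)
    (hp : ∀ i, π ≤ p i) (hp1 : ∑ i, p i = 1) (hu1 : ∑ i, p i * u i = 1)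
    (hη : 0 < η) (hηπ : η / π ≤ 1 / 2) (hu : ∀ i, u i ≤ 1 + η) :
    (∀ i, 0 < u i) ∧ -(2 * (η / π) ^ 2) ≤ ∑ i, p i * Real.log (u i) := by
  have hp0 : ∀ i, 0 ≤ p i := fun i => hπ.le.trans (hp i)
  have hlow : ∀ i, -(η / π) ≤ u i - 1 := by
    intro i
    have h1 : p i * (1 + η - u i) ≤ ∑ j, p j * (1 + η - u j) :=
      Finset.single_le_sum (f := fun j => p j * (1 + η - u j))
        (fun j _ => mul_nonneg (hp0 j) (by linarith [hu j])) (Finset.mem_univ i)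
    have h2 : ∑ j, p j * (1 + η - u j) = η := by
      simp_rw [mul_sub]
      rw [Finset.sum_sub_distrib, ← Finset.sum_mul, hp1, hu1]
      ring
    have h3 : π * (1 + η - u i) ≤ p i * (1 + η - u i) :=
      mul_le_mul_of_nonneg_right (hp i) (by linarith [hu i])
    have h4 : 1 + η - u i ≤ η / π := by
      rw [le_div_iff₀ hπ]
      linarith
    linarith
  have hle : ∀ i, u i - 1 ≤ η / π := by
    intro i
    have hπ1 : π ≤ 1 := by
      have := Finset.single_le_sum (f := p) (fun j _ => hp0 j) (Finset.mem_univ i)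
      linarith [hp i]
    have : η ≤ η / π := by
      rw [le_div_iff₀ hπ]
      nlinarith
    linarith [hu i]
  have hpos : ∀ i, 1 / 2 ≤ u i := fun i => by linarith [hlow i]
  refine ⟨fun i => by linarith [hpos i], ?_⟩
  have hlog : ∀ i, (u i - 1) - 2 * (η / π) ^ 2 ≤ Real.log (u i) := by
    intro i
    have hui : 0 < u i := by linarith [hpos i]
    have h1 := Real.one_sub_inv_le_log_of_pos hui
    have h2 : (u i - 1) ^ 2 ≤ (η / π) ^ 2 := sq_le_sq' (hlow i) (hle i)
    have h3 : (u i)⁻¹ ≤ 2 := by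
      rw [inv_le_comm₀ hui (by norm_num)]
      linarith [hpos i]
    have h4 : 1 - (u i)⁻¹ = (u i - 1) - (u i - 1) ^ 2 * (u i)⁻¹ := by
      field_simp
      ring
    nlinarith [sq_nonneg (u i - 1)]
  calc -(2 * (η / π) ^ 2) = ∑ i, p i * ((u i - 1) - 2 * (η / π) ^ 2) := by
        have : ∀ i, p i * ((u i - 1) - 2 * (η / π) ^ 2)
            = p i * u i - p i * (1 + 2 * (η / π) ^ 2) := fun i => by ring
        simp_rw [this]
        rw [Finset.sum_sub_distrib, ← Finset.sum_mul, hp1, hu1]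
        ring
    _ ≤ _ := Finset.sum_le_sum fun i _ => mul_le_mul_of_nonneg_left (hlog i) (hp0 i)

lemma sum_mul_fst (P : X × Y → ℝ) (f : X → ℝ) : ∑ z, P z * f z.1 = ∑ x, margX P x * f x := by
  simp [Fintype.sum_prod_type, margX, Finset.sum_mul]

lemma sum_mul_snd (P : X × Y → ℝ) (f : Y → ℝ) : ∑ z, P z * f z.2 = ∑ y, margY P y * f y := by
  simp [Fintype.sum_prod_type_right, margY, Finset.sum_mul]

/-- A reverse-hypercontractive inequality, for functions normalized to have mean one. -/
lemma exists_pow_le_sum_of_mean_one (P Q P' : X × Y → ℝ) (hP : IsPos P) (hQ : IsPos Q)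
    (hP' : IsDist P') (hX : margX P' = margX P) (hY : margY P' = margY P) {ε : ℝ} (hε : 0 < ε) :
    ∃ s : ℕ, 0 < s ∧ ∀ (u : X → ℝ) (v : Y → ℝ), (∀ x, 0 ≤ u x) → (∀ y, 0 ≤ v y) →
      ∑ x, margX P x * u x = 1 → ∑ y, margY P y * v y = 1 →
      Real.exp (-(relEnt P' Q + ε)) ≤ ∑ z, Q z * ((u z.1) ^ s * (v z.2) ^ s) := by
  obtain ⟨z0⟩ : Nonempty (X × Y) := by
    by_contra h
    rw [not_nonempty_iff] at h
    simpa using hP.2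
  obtain ⟨w, -, hw⟩ := Finset.exists_min_image Finset.univ (fun z => min (P z) (Q z)) ⟨z0, by simp⟩
  set π := min (P w) (Q w) with hπdef
  have hπ : 0 < π := lt_min (hP.1 w) (hQ.1 w)
  have hPπ : ∀ z, π ≤ P z := fun z => (hw z (Finset.mem_univ z)).trans (min_le_left _ _)
  have hQπ : ∀ z, π ≤ Q z := fun z => (hw z (Finset.mem_univ z)).trans (min_le_right _ _)
  have hXπ : ∀ x, π ≤ margX P x := fun x => (hPπ (x, z0.2)).trans
    (Finset.single_le_sum (f := fun y => P (x, y)) (fun y _ => (hP.1 _).le) (Finset.mem_univ _))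
  have hYπ : ∀ y, π ≤ margY P y := fun y => (hPπ (z0.1, y)).trans
    (Finset.single_le_sum (f := fun x => P (x, y)) (fun y _ => (hP.1 _).le) (Finset.mem_univ _))
  have hX1 : ∑ x, margX P x = 1 := by
    rw [← hP.2, Fintype.sum_prod_type]; rfl
  have hY1 : ∑ y, margY P y = 1 := by
    rw [← hP.2, Fintype.sum_prod_type_right]; rfl
  set c := Real.exp (-(relEnt P' Q + ε)) with hc
  obtain ⟨m, hm⟩ := exists_nat_gt (max (max (c / π) (2 / π)) (max 1 (4 / (π ^ 2 * ε))))
  have hm1 : c / π < m := ((le_max_left _ _).trans (le_max_left _ _)).trans_lt hm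
  have hm2 : 2 / π < m := ((le_max_right _ _).trans (le_max_left _ _)).trans_lt hm
  have hm3 : 1 < (m : ℝ) := ((le_max_left _ _).trans (le_max_right _ _)).trans_lt hm
  have hm4 : 4 / (π ^ 2 * ε) < m := ((le_max_right _ _).trans (le_max_right _ _)).trans_lt hm
  have hm0 : 0 < (m : ℝ) := by linarith
  set η : ℝ := 1 / (m : ℝ) ^ 2 with hη
  have hη0 : 0 < η := by positivity
  refine ⟨m ^ 3, by have : 0 < m := by exact_mod_cast hm0
                    positivity, fun u v hu hv hu1 hv1 => ?_⟩
  have hterm : ∀ z, 0 ≤ Q z * ((u z.1) ^ m ^ 3 * (v z.2) ^ m ^ 3) := fun z =>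
    mul_nonneg (hQ.1 z).le (mul_nonneg (pow_nonneg (hu _) _) (pow_nonneg (hv _) _))
  by_cases hbig : ∃ z : X × Y, 1 + η ≤ u z.1 * v z.2
  · obtain ⟨z, hz⟩ := hbig
    have h1 : (m : ℝ) ≤ (u z.1) ^ m ^ 3 * (v z.2) ^ m ^ 3 := by
      rw [← mul_pow]
      calc (m : ℝ) ≤ 1 + ((m ^ 3 : ℕ) : ℝ) * η := by
            have : ((m ^ 3 : ℕ) : ℝ) * η = m := by
              rw [hη]; push_cast; field_simp
            linarith
        _ ≤ (1 + η) ^ m ^ 3 := one_add_mul_le_pow (by linarith) _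
        _ ≤ _ := pow_le_pow_left₀ (by linarith) hz _
    calc c ≤ π * m := by
          rw [div_lt_iff₀ hπ] at hm1; linarith
      _ ≤ Q z * ((u z.1) ^ m ^ 3 * (v z.2) ^ m ^ 3) :=
          mul_le_mul (hQπ z) h1 hm0.le (hQ.1 z).le
      _ ≤ _ := Finset.single_le_sum
          (f := fun z => Q z * ((u z.1) ^ m ^ 3 * (v z.2) ^ m ^ 3))
          (fun z _ => hterm z) (Finset.mem_univ z)
  · push Not at hbig
    have hηπ : η / π ≤ 1 / 2 := by
      rw [hη, div_div, div_le_div_iff₀ (by positivity) (by norm_num)]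
      rw [div_lt_iff₀ hπ] at hm2
      nlinarith
    obtain ⟨x1, hx1⟩ := exists_one_le_of_sum_mul_eq_one _ u (fun x => hπ.le.trans (hXπ x)) hX1 hu1
    obtain ⟨y1, hy1⟩ := exists_one_le_of_sum_mul_eq_one _ v (fun y => hπ.le.trans (hYπ y)) hY1 hv1
    have huη : ∀ x, u x ≤ 1 + η := fun x => by nlinarith [hbig (x, y1), hu x]
    have hvη : ∀ y, v y ≤ 1 + η := fun y => by nlinarith [hbig (x1, y), hv y]
    obtain ⟨hu0, hul⟩ := neg_le_sum_mul_log _ u hπ hXπ hX1 hu1 hη0 hηπ huη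
    obtain ⟨hv0, hvl⟩ := neg_le_sum_mul_log _ v hπ hYπ hY1 hv1 hη0 hηπ hvη
    refine le_trans (Real.exp_le_exp.mpr ?_) (exp_sum_mul_log_le P'
      (fun z => Q z * ((u z.1) ^ m ^ 3 * (v z.2) ^ m ^ 3)) hP'.1 hP'.2 fun z =>
        mul_pos (hQ.1 z) (mul_pos (pow_pos (hu0 _) _) (pow_pos (hv0 _) _)))
    have hsplit : ∀ z, P' z * Real.log (Q z * ((u z.1) ^ m ^ 3 * (v z.2) ^ m ^ 3) / P' z)
        = -(P' z * Real.log (P' z / Q z)) + (m : ℝ) ^ 3 * (P' z * Real.log (u z.1))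
          + (m : ℝ) ^ 3 * (P' z * Real.log (v z.2)) := by
      intro z
      rcases (hP'.1 z).eq_or_lt with h0 | h0
      · simp [← h0]
      · have hQz := (hQ.1 z).ne'
        have huz := (pow_pos (hu0 z.1) (m ^ 3)).ne'
        have hvz := (pow_pos (hv0 z.2) (m ^ 3)).ne'
        rw [Real.log_div (mul_ne_zero hQz (mul_ne_zero huz hvz)) h0.ne', Real.log_mul hQz
          (mul_ne_zero huz hvz), Real.log_mul huz hvz, Real.log_div h0.ne' hQz, Real.log_pow,
          Real.log_pow]
        push_cast
        ring
    simp_rw [hsplit]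
    rw [Finset.sum_add_distrib, Finset.sum_add_distrib, Finset.sum_neg_distrib, ← Finset.mul_sum,
      ← Finset.mul_sum, sum_mul_fst P' (fun x => Real.log (u x)),
      sum_mul_snd P' (fun y => Real.log (v y)), hX, hY]
    have hsmall : (m : ℝ) ^ 3 * (2 * (η / π) ^ 2) ≤ ε / 2 := by
      have : (m : ℝ) ^ 3 * (2 * (η / π) ^ 2) = 2 / (m * π ^ 2) := by
        rw [hη]; field_simp
      rw [this, div_le_div_iff₀ (by positivity) (by norm_num)]
      rw [div_lt_iff₀ (by positivity)] at hm4
      linarith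
    have hm3' : 0 ≤ (m : ℝ) ^ 3 := by positivity
    have e1 := mul_le_mul_of_nonneg_left hul hm3'
    have e2 := mul_le_mul_of_nonneg_left hvl hm3'
    have e3 : ∑ z, P' z * Real.log (P' z / Q z) = relEnt P' Q := rfl
    rw [e3]
    linarith

/-- A reverse-hypercontractive inequality: the exponent `s` depends on the distributions and
on `ε` only. -/
lemma exists_mul_pow_le_sum (P Q P' : X × Y → ℝ) (hP : IsPos P) (hQ : IsPos Q)
    (hP' : IsDist P') (hX : margX P' = margX P) (hY : margY P' = margY P) {ε : ℝ} (hε : 0 < ε) :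
    ∃ s : ℕ, 0 < s ∧ ∀ (u : X → ℝ) (v : Y → ℝ), (∀ x, 0 ≤ u x) → (∀ y, 0 ≤ v y) →
      Real.exp (-(relEnt P' Q + ε)) * ((∑ x, margX P x * u x) ^ s * (∑ y, margY P y * v y) ^ s)
        ≤ ∑ z, Q z * ((u z.1) ^ s * (v z.2) ^ s) := by
  obtain ⟨s, hs, h⟩ := exists_pow_le_sum_of_mean_one P Q P' hP hQ hP' hX hY hε
  refine ⟨s, hs, fun u v hu hv => ?_⟩
  set U := ∑ x, margX P x * u x with hU
  set V := ∑ y, margY P y * v y with hV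
  have hU0 : 0 ≤ U := Finset.sum_nonneg fun x _ =>
    mul_nonneg (Finset.sum_nonneg fun y _ => (hP.1 _).le) (hu x)
  have hV0 : 0 ≤ V := Finset.sum_nonneg fun y _ =>
    mul_nonneg (Finset.sum_nonneg fun x _ => (hP.1 _).le) (hv y)
  have hR : 0 ≤ ∑ z, Q z * ((u z.1) ^ s * (v z.2) ^ s) := Finset.sum_nonneg fun z _ =>
    mul_nonneg (hQ.1 z).le (mul_nonneg (pow_nonneg (hu _) _) (pow_nonneg (hv _) _))
  rcases hU0.eq_or_lt with hU' | hU'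
  · simpa [← hU', hs.ne'] using hR
  rcases hV0.eq_or_lt with hV' | hV'
  · simpa [← hV', hs.ne'] using hR
  have := h (fun x => u x / U) (fun y => v y / V) (fun x => div_nonneg (hu x) hU0)
    (fun y => div_nonneg (hv y) hV0)
    (by simp_rw [← mul_div_assoc]; rw [← Finset.sum_div, ← hU, div_self hU'.ne'])
    (by simp_rw [← mul_div_assoc]; rw [← Finset.sum_div, ← hV, div_self hV'.ne'])
  have h2 : ∑ z, Q z * ((u z.1 / U) ^ s * (v z.2 / V) ^ s)
      = (∑ z, Q z * ((u z.1) ^ s * (v z.2) ^ s)) / (U ^ s * V ^ s) := by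
    rw [Finset.sum_div]
    refine Finset.sum_congr rfl fun z _ => ?_
    rw [div_pow, div_pow]
    field_simp
  rw [h2, le_div_iff₀ (by positivity)] at this
  exact this

end SingleLetter

section Tensorization

lemma sum_fin_succ_fun {α : Type*} [Fintype α] {n : ℕ} (F : (Fin (n + 1) → α) → ℝ) :
    ∑ x, F x = ∑ a, ∑ x : Fin n → α, F (Fin.cons a x) := by
  rw [← Fintype.sum_prod_type' (f := fun a (x : Fin n → α) => F (Fin.cons a x))]
  exact (Fintype.sum_equiv (Fin.consEquiv fun _ => α) _ _ fun _ => rfl).symm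

/-- The inequality of `exists_mul_pow_le_sum` tensorizes. -/
lemma pow_mul_pow_le_sum_prod (p : X → ℝ) (q : Y → ℝ) (Q : X × Y → ℝ) (c : ℝ) (s : ℕ)
    (hp : ∀ x, 0 ≤ p x) (hq : ∀ y, 0 ≤ q y) (hQ : ∀ z, 0 ≤ Q z) (hc : 0 ≤ c)
    (h : ∀ (u : X → ℝ) (v : Y → ℝ), (∀ x, 0 ≤ u x) → (∀ y, 0 ≤ v y) →
      c * ((∑ x, p x * u x) ^ s * (∑ y, q y * v y) ^ s)
        ≤ ∑ x, ∑ y, Q (x, y) * ((u x) ^ s * (v y) ^ s)) (n : ℕ) :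
    ∀ (u : (Fin n → X) → ℝ) (v : (Fin n → Y) → ℝ), (∀ x, 0 ≤ u x) → (∀ y, 0 ≤ v y) →
      c ^ n * ((∑ x, (∏ i, p (x i)) * u x) ^ s * (∑ y, (∏ i, q (y i)) * v y) ^ s)
        ≤ ∑ x, ∑ y, (∏ i, Q (x i, y i)) * ((u x) ^ s * (v y) ^ s) := by
  induction n with
  | zero =>
    intro u v hu hv
    simp
  | succ n ih =>
    intro u v hu hv
    set U : X → ℝ := fun a => ∑ x : Fin n → X, (∏ i, p (x i)) * u (Fin.cons a x) with hU
    set V : Y → ℝ := fun b => ∑ y : Fin n → Y, (∏ i, q (y i)) * v (Fin.cons b y) with hV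
    have hU0 : ∀ a, 0 ≤ U a := fun a => Finset.sum_nonneg fun x _ =>
      mul_nonneg (Finset.prod_nonneg fun i _ => hp _) (hu _)
    have hV0 : ∀ a, 0 ≤ V a := fun a => Finset.sum_nonneg fun x _ =>
      mul_nonneg (Finset.prod_nonneg fun i _ => hq _) (hv _)
    have e1 : ∑ x, (∏ i, p (x i)) * u x = ∑ a, p a * U a := by
      rw [sum_fin_succ_fun]
      simp [hU, Fin.prod_univ_succ, Finset.mul_sum, mul_assoc]
    have e2 : ∑ y, (∏ i, q (y i)) * v y = ∑ a, q a * V a := by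
      rw [sum_fin_succ_fun]
      simp [hV, Fin.prod_univ_succ, Finset.mul_sum, mul_assoc]
    have e3 : ∑ x, ∑ y, (∏ i, Q (x i, y i)) * ((u x) ^ s * (v y) ^ s)
        = ∑ a, ∑ b, Q (a, b) * ∑ x : Fin n → X, ∑ y : Fin n → Y, (∏ i, Q (x i, y i)) *
            ((u (Fin.cons a x)) ^ s * (v (Fin.cons b y)) ^ s) := by
      rw [sum_fin_succ_fun]
      refine Finset.sum_congr rfl fun a _ => ?_
      simp_rw [sum_fin_succ_fun (α := Y)]
      rw [Finset.sum_comm]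
      simp [Fin.prod_univ_succ, Finset.mul_sum, mul_assoc]
    rw [e1, e2, e3]
    calc c ^ (n + 1) * ((∑ a, p a * U a) ^ s * (∑ a, q a * V a) ^ s)
        = c ^ n * (c * ((∑ a, p a * U a) ^ s * (∑ a, q a * V a) ^ s)) := by ring
      _ ≤ c ^ n * ∑ a, ∑ b, Q (a, b) * ((U a) ^ s * (V b) ^ s) :=
          mul_le_mul_of_nonneg_left (h U V hU0 hV0) (by positivity)
      _ = ∑ a, ∑ b, Q (a, b) * (c ^ n * ((U a) ^ s * (V b) ^ s)) := by
          simp_rw [Finset.mul_sum]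
          refine Finset.sum_congr rfl fun a _ => Finset.sum_congr rfl fun b _ => by ring
      _ ≤ _ := Finset.sum_le_sum fun a _ => Finset.sum_le_sum fun b _ =>
          mul_le_mul_of_nonneg_left (ih _ _ (fun _ => hu _) (fun _ => hv _)) (hQ _)

lemma sum_prod_eq_pow (g : X × Y → ℝ) (n : ℕ) :
    ∑ z : (Fin n → X) × (Fin n → Y), ∏ i, g (z.1 i, z.2 i) = (∑ z, g z) ^ n := by
  rw [Fintype.sum_pow]
  exact (Fintype.sum_equiv (Equiv.arrowProdEquivProdArrow (Fin n) (fun _ => X) (fun _ => Y)) _ _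
    fun _ => rfl).symm

lemma prodProb_nonneg (P : X × Y → ℝ) (hP : ∀ z, 0 ≤ P z) (n : ℕ)
    (A : Set ((Fin n → X) × (Fin n → Y))) : 0 ≤ prodProb P n A :=
  Finset.sum_nonneg fun z _ => by
    split_ifs
    · exact Finset.prod_nonneg fun i _ => hP _
    · exact le_rfl

lemma prodProb_mono (P : X × Y → ℝ) (hP : ∀ z, 0 ≤ P z) {n : ℕ}
    {A B : Set ((Fin n → X) × (Fin n → Y))} (h : A ⊆ B) : prodProb P n A ≤ prodProb P n B :=
  Finset.sum_le_sum fun z _ => by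
    by_cases hA : z ∈ A
    · rw [if_pos hA, if_pos (h hA)]
    · rw [if_neg hA]
      split_ifs
      · exact Finset.prod_nonneg fun i _ => hP _
      · exact le_rfl

lemma prodProb_union_le (P : X × Y → ℝ) (hP : ∀ z, 0 ≤ P z) {n : ℕ}
    (A B : Set ((Fin n → X) × (Fin n → Y))) :
    prodProb P n (A ∪ B) ≤ prodProb P n A + prodProb P n B := by
  rw [prodProb, prodProb, prodProb, ← Finset.sum_add_distrib]
  refine Finset.sum_le_sum fun z _ => ?_
  have : 0 ≤ ∏ i, P (z.1 i, z.2 i) := Finset.prod_nonneg fun i _ => hP _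
  by_cases hA : z ∈ A <;> by_cases hB : z ∈ B <;> simp [hA, hB, this]

/-- The exponential Markov inequality for additive functions. -/
lemma prodProb_le_pow (P w : X × Y → ℝ) (hP : ∀ z, 0 ≤ P z) {n : ℕ}
    (A : Set ((Fin n → X) × (Fin n → Y))) (hA : ∀ z ∈ A, 0 ≤ ∑ i, w (z.1 i, z.2 i)) :
    prodProb P n A ≤ (∑ z, P z * Real.exp (w z)) ^ n := by
  rw [← sum_prod_eq_pow]
  refine Finset.sum_le_sum fun z _ => ?_
  have h0 : 0 ≤ ∏ i, P (z.1 i, z.2 i) := Finset.prod_nonneg fun i _ => hP _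
  rw [Finset.prod_mul_distrib, ← Real.exp_sum]
  split_ifs with hz
  · exact le_mul_of_one_le_right h0 (Real.one_le_exp (hA z hz))
  · exact mul_nonneg h0 (Real.exp_pos _).le

lemma prodProb_le_one (P : X × Y → ℝ) (hP : IsPos P) (n : ℕ)
    (A : Set ((Fin n → X) × (Fin n → Y))) : prodProb P n A ≤ 1 := by
  have := prodProb_le_pow P 0 (fun z => (hP.1 z).le) A (fun z _ => by simp)
  simpa [hP.2] using this

lemma alphaErr_eq (P : X × Y → ℝ) (hP : IsPos P) {n : ℕ} (T : Scheme X Y n) :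
    alphaErr P T = 1 - betaErr P T := by
  have h : ∑ z : (Fin n → X) × (Fin n → Y), ∏ i, P (z.1 i, z.2 i) = 1 := by
    rw [sum_prod_eq_pow, hP.2, one_pow]
  rw [eq_sub_iff_add_eq, ← h, alphaErr, betaErr, prodProb, prodProb, ← Finset.sum_add_distrib]
  refine Finset.sum_congr rfl fun z _ => ?_
  cases hz : T.g (T.f1 z.1) (T.f2 z.2) <;> simp [hz]

lemma prodProb_prod_le_fst (P : X × Y → ℝ) (hP : ∀ z, 0 ≤ P z) {n : ℕ}
    (A : Set (Fin n → X)) (B : Set (Fin n → Y)) :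
    prodProb P n (A ×ˢ B) ≤ ∑ x, (∏ i, margX P (x i)) * (if x ∈ A then 1 else 0) := by
  have h : ∀ x : Fin n → X, ∏ i, margX P (x i) = ∑ y : Fin n → Y, ∏ i, P (x i, y i) := by
    intro x
    simp only [margX]
    rw [Finset.prod_univ_sum, Fintype.piFinset_univ]
  rw [prodProb, Fintype.sum_prod_type]
  refine Finset.sum_le_sum fun x _ => ?_
  rw [h, Finset.sum_mul]
  refine Finset.sum_le_sum fun y _ => ?_
  have : 0 ≤ ∏ i, P (x i, y i) := Finset.prod_nonneg fun i _ => hP _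
  by_cases hA : x ∈ A <;> by_cases hB : y ∈ B <;> simp [hA, hB, this]

lemma prodProb_prod_le_snd (P : X × Y → ℝ) (hP : ∀ z, 0 ≤ P z) {n : ℕ}
    (A : Set (Fin n → X)) (B : Set (Fin n → Y)) :
    prodProb P n (A ×ˢ B) ≤ ∑ y, (∏ i, margY P (y i)) * (if y ∈ B then 1 else 0) := by
  have h : ∀ y : Fin n → Y, ∏ i, margY P (y i) = ∑ x : Fin n → X, ∏ i, P (x i, y i) := by
    intro y
    simp only [margY]
    rw [Finset.prod_univ_sum, Fintype.piFinset_univ]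
  rw [prodProb, Fintype.sum_prod_type_right]
  refine Finset.sum_le_sum fun y _ => ?_
  rw [h, Finset.sum_mul]
  refine Finset.sum_le_sum fun x _ => ?_
  have : 0 ≤ ∏ i, P (x i, y i) := Finset.prod_nonneg fun i _ => hP _
  by_cases hA : x ∈ A <;> by_cases hB : y ∈ B <;> simp [hA, hB, this]

end Tensorization

section Converse

/-- Rectangles of not too small probability under `P` have a probability under `Q` that is
not much below `exp (-n D(P'‖Q))`. -/
lemma exists_pow_mul_pow_le_prodProb_prod (P Q P' : X × Y → ℝ) (hP : IsPos P) (hQ : IsPos Q)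
    (hP' : IsDist P') (hX : margX P' = margX P) (hY : margY P' = margY P) {ε : ℝ} (hε : 0 < ε) :
    ∃ s : ℕ, ∀ (n : ℕ) (A : Set (Fin n → X)) (B : Set (Fin n → Y)),
      Real.exp (-(relEnt P' Q + ε)) ^ n * (prodProb P n (A ×ˢ B)) ^ (2 * s)
        ≤ prodProb Q n (A ×ˢ B) := by
  obtain ⟨s, hs, h⟩ := exists_mul_pow_le_sum P Q P' hP hQ hP' hX hY hε
  refine ⟨s, fun n A B => ?_⟩
  have hP0 : ∀ z, 0 ≤ P z := fun z => (hP.1 z).le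
  have hrect := pow_mul_pow_le_sum_prod (margX P) (margY P) Q (Real.exp (-(relEnt P' Q + ε))) s
    (fun x => Finset.sum_nonneg fun y _ => hP0 _) (fun y => Finset.sum_nonneg fun x _ => hP0 _)
    (fun z => (hQ.1 z).le) (Real.exp_pos _).le
    (fun u v hu hv => by
      have := h u v hu hv
      rwa [Fintype.sum_prod_type] at this) n
    (fun x => if x ∈ A then 1 else 0) (fun y => if y ∈ B then 1 else 0)
    (fun x => by split_ifs <;> norm_num) (fun x => by split_ifs <;> norm_num)
  have hR := prodProb_nonneg P hP0 n (A ×ˢ B)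
  calc Real.exp (-(relEnt P' Q + ε)) ^ n * (prodProb P n (A ×ˢ B)) ^ (2 * s)
      = Real.exp (-(relEnt P' Q + ε)) ^ n *
          (prodProb P n (A ×ˢ B) ^ s * prodProb P n (A ×ˢ B) ^ s) := by ring
    _ ≤ _ := by
        refine mul_le_mul_of_nonneg_left ?_ (by positivity)
        exact mul_le_mul (pow_le_pow_left₀ hR (prodProb_prod_le_fst P hP0 A B) s)
          (pow_le_pow_left₀ hR (prodProb_prod_le_snd P hP0 A B) s) (pow_nonneg hR s)
          (pow_nonneg (hR.trans (prodProb_prod_le_fst P hP0 A B)) s)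
    _ ≤ _ := hrect
    _ = _ := by
        rw [prodProb, Fintype.sum_prod_type]
        refine Finset.sum_congr rfl fun x _ => Finset.sum_congr rfl fun y _ => ?_
        by_cases hA : x ∈ A <;> by_cases hB : y ∈ B <;> simp [hA, hB, hs.ne']

lemma betaErr_eq_sum (P : X × Y → ℝ) {n : ℕ} (T : Scheme X Y n) :
    betaErr P T = ∑ k : Fin T.m1 × Fin T.m2,
      if T.g k.1 k.2 = true then prodProb P n ((T.f1 ⁻¹' {k.1}) ×ˢ (T.f2 ⁻¹' {k.2})) else 0 := by
  have h : ∀ k : Fin T.m1 × Fin T.m2,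
      (if T.g k.1 k.2 = true then prodProb P n ((T.f1 ⁻¹' {k.1}) ×ˢ (T.f2 ⁻¹' {k.2})) else 0)
        = ∑ z : (Fin n → X) × (Fin n → Y), if k = (T.f1 z.1, T.f2 z.2) then
            (if T.g k.1 k.2 = true then ∏ i, P (z.1 i, z.2 i) else 0) else 0 := by
    rintro ⟨i, j⟩
    by_cases hg : T.g i j = true
    · simp [hg, prodProb, eq_comm]
    · simp [hg]
  simp_rw [h]
  rw [Finset.sum_comm]
  simp only [betaErr, prodProb, Set.mem_ofPred_eq]
  refine Finset.sum_congr rfl fun z _ => ?_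
  split_ifs with hg <;> simp [hg]

/-- Some accepting pair of messages carries its share of the acceptance probability. -/
lemma exists_rectangle (P : X × Y → ℝ) {n : ℕ} (T : Scheme X Y n) (hβ : 0 < betaErr P T) :
    0 < T.m1 ∧ 0 < T.m2 ∧ ∃ i j, T.g i j = true ∧ betaErr P T / (T.m1 * T.m2 : ℝ) ≤
      prodProb P n ((T.f1 ⁻¹' {i}) ×ˢ (T.f2 ⁻¹' {j})) := by
  have hne : (Finset.univ : Finset (Fin T.m1 × Fin T.m2)).Nonempty := by
    by_contra hemp
    rw [Finset.not_nonempty_iff_eq_empty] at hemp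
    rw [betaErr_eq_sum, hemp, Finset.sum_empty] at hβ
    exact hβ.false
  obtain ⟨k0, -⟩ := hne
  have h1 : 0 < T.m1 := k0.1.pos
  have h2 : 0 < T.m2 := k0.2.pos
  have hN : (0 : ℝ) < T.m1 * T.m2 := by positivity
  obtain ⟨k, -, hk⟩ := Finset.exists_le_of_sum_le (s := Finset.univ) ⟨k0, Finset.mem_univ _⟩
    (f := fun _ : Fin T.m1 × Fin T.m2 => betaErr P T / (T.m1 * T.m2 : ℝ))
    (g := fun k => if T.g k.1 k.2 = true then
      prodProb P n ((T.f1 ⁻¹' {k.1}) ×ˢ (T.f2 ⁻¹' {k.2})) else 0) (by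
        rw [← betaErr_eq_sum]
        simp only [Finset.sum_const, Finset.card_univ, Fintype.card_prod, Fintype.card_fin,
          nsmul_eq_mul, Nat.cast_mul]
        rw [mul_div_cancel₀ _ hN.ne'])
  have hpos : 0 < betaErr P T / (T.m1 * T.m2 : ℝ) := div_pos hβ hN
  refine ⟨h1, h2, k.1, k.2, ?_⟩
  by_cases hg : T.g k.1 k.2 = true
  · simp only [hg, if_true] at hk
    exact ⟨hg, hk⟩
  · simp only [hg] at hk
    exact absurd hk (by simpa using hpos)

lemma eventually_neg_log_betaErr_le (P Q P' : X × Y → ℝ) (hP : IsPos P) (hQ : IsPos Q)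
    (hP' : IsDist P') (hX : margX P' = margX P) (hY : margY P' = margY P)
    (T : (n : ℕ) → Scheme X Y n) (hT : ZeroRate T)
    (hα : Tendsto (fun n : ℕ => alphaErr P (T n)) atTop (𝓝 0)) {ε : ℝ} (hε : 0 < ε) :
    ∀ᶠ n : ℕ in atTop, -(1 / (n : ℝ)) * Real.log (betaErr Q (T n)) ≤ relEnt P' Q + ε := by
  obtain ⟨s, hs⟩ := exists_pow_mul_pow_le_prodProb_prod P Q P' hP hQ hP' hX hY (half_pos hε)
  have hlim : Tendsto (fun n : ℕ => 2 * (s : ℝ) * (Real.log 2 / (n : ℝ) +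
      Real.log ((T n).m1 : ℝ) / (n : ℝ) + Real.log ((T n).m2 : ℝ) / (n : ℝ))) atTop (𝓝 0) := by
    have := (((tendsto_const_div_atTop_nhds_zero_nat (Real.log 2)).add hT.1).add hT.2).const_mul
      (2 * (s : ℝ))
    simpa using this
  filter_upwards [hα.eventually (gt_mem_nhds (by norm_num : (0 : ℝ) < 1 / 2)),
    hlim.eventually (gt_mem_nhds (half_pos hε)), eventually_gt_atTop 0] with n h1 h2 hn
  have hn' : (0 : ℝ) < n := by exact_mod_cast hn
  have hβP : 1 / 2 < betaErr P (T n) := by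
    rw [alphaErr_eq P hP] at h1
    linarith
  obtain ⟨hm1, hm2, i, j, hg, hij⟩ := exists_rectangle P (T n) (by linarith)
  have hm1' : (0 : ℝ) < (T n).m1 := by exact_mod_cast hm1
  have hm2' : (0 : ℝ) < (T n).m2 := by exact_mod_cast hm2
  set A := (T n).f1 ⁻¹' {i}
  set B := (T n).f2 ⁻¹' {j}
  have hAB : 1 / (2 * (T n).m1 * (T n).m2) ≤ prodProb P n (A ×ˢ B) := by
    refine le_trans ?_ hij
    rw [le_div_iff₀ (by positivity)]
    refine le_trans (le_of_eq ?_) hβP.le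
    field_simp
  have hsub : A ×ˢ B ⊆ {z : (Fin n → X) × (Fin n → Y) |
      (T n).g ((T n).f1 z.1) ((T n).f2 z.2) = true} := by
    rintro ⟨x, y⟩ ⟨hx, hy⟩
    simp only [A, B, Set.mem_preimage, Set.mem_singleton_iff] at hx hy
    simpa [hx, hy] using hg
  have hβ : Real.exp (-(relEnt P' Q + ε / 2)) ^ n *
      (1 / (2 * (T n).m1 * (T n).m2 : ℝ)) ^ (2 * s) ≤ betaErr Q (T n) :=
    (mul_le_mul_of_nonneg_left (pow_le_pow_left₀ (by positivity) hAB _) (by positivity)).trans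
      ((hs n A B).trans (prodProb_mono Q (fun z => (hQ.1 z).le) hsub))
  have hlog := Real.log_le_log (by positivity) hβ
  rw [Real.log_mul (by positivity) (by positivity), Real.log_pow, Real.log_exp, Real.log_pow,
    one_div, Real.log_inv, Real.log_mul (by positivity) (by positivity),
    Real.log_mul (by positivity) (by positivity)] at hlog
  push_cast at hlog
  have e : 2 * (s : ℝ) * (Real.log 2 / (n : ℝ) +
      Real.log ((T n).m1 : ℝ) / (n : ℝ) + Real.log ((T n).m2 : ℝ) / (n : ℝ))
      = 2 * s * (Real.log 2 + Real.log (T n).m1 + Real.log (T n).m2) / n := by ring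
  rw [e, div_lt_iff₀ hn'] at h2
  rw [neg_mul, one_div_mul_eq_div, neg_le, le_div_iff₀ hn']
  nlinarith

lemma liminf_neg_log_betaErr_le (P Q P' : X × Y → ℝ) (hP : IsPos P) (hQ : IsPos Q)
    (hP' : IsDist P') (hX : margX P' = margX P) (hY : margY P' = margY P)
    (T : (n : ℕ) → Scheme X Y n) (hT : ZeroRate T)
    (hα : Tendsto (fun n : ℕ => alphaErr P (T n)) atTop (𝓝 0)) :
    liminf (fun n : ℕ => -(1 / (n : ℝ)) * Real.log (betaErr Q (T n))) atTop ≤ relEnt P' Q := by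
  have hbdd : IsBoundedUnder (· ≥ ·) atTop
      (fun n : ℕ => -(1 / (n : ℝ)) * Real.log (betaErr Q (T n))) := by
    refine isBoundedUnder_of ⟨0, fun n => ?_⟩
    have h1 : Real.log (betaErr Q (T n)) ≤ 0 := Real.log_nonpos
      (prodProb_nonneg Q (fun z => (hQ.1 z).le) n _) (prodProb_le_one Q hQ n _)
    have h2 : 0 ≤ 1 / (n : ℝ) := by positivity
    simp only [ge_iff_le]
    nlinarith
  refine liminf_le_of_le hbdd fun b hb => le_of_forall_pos_le_add fun ε hε => ?_
  obtain ⟨n, h1, h2⟩ := (hb.and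
    (eventually_neg_log_betaErr_le P Q P' hP hQ hP' hX hY T hT hα hε)).exists
  exact h1.trans h2

end Converse

section Symmetric

lemma sum_eq_mul_sum_empDist {n : ℕ} (hn : 0 < n) (a : X → ℝ) (x : Fin n → X) :
    ∑ i, a (x i) = n * ∑ c, a c * empDist x c := by
  have hn' : (n : ℝ) ≠ 0 := by positivity
  rw [← Finset.sum_fiberwise_of_maps_to (s := Finset.univ) (t := Finset.univ) (g := x)
    (fun i _ => Finset.mem_univ _), Finset.mul_sum]
  refine Finset.sum_congr rfl fun c _ => ?_
  rw [Finset.sum_congr rfl (g := fun _ => a c) (fun i hi => by rw [(Finset.mem_filter.mp hi).2]),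
    Finset.sum_const, nsmul_eq_mul, empDist]
  field_simp

/-- The numbers of occurrences of each letter, as one of polynomially many messages. -/
def countCode {n : ℕ} (x : Fin n → X) : Fin ((n + 1) ^ Fintype.card X) :=
  Fintype.equivFinOfCardEq (α := X → Fin (n + 1)) (by simp)
    fun a => ⟨(Finset.univ.filter fun i => x i = a).card,
      Nat.lt_succ_of_le ((Finset.card_le_univ _).trans (by simp))⟩

lemma empDist_eq_of_countCode_eq {n : ℕ} {x x' : Fin n → X} (h : countCode x = countCode x') :
    empDist x = empDist x' := by
  funext a
  have := congrFun ((Equiv.injective _) h) a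
  rw [Fin.mk.injEq] at this
  rw [empDist, empDist, this]

lemma tendsto_log_card_countCode (k : ℕ) :
    Tendsto (fun n : ℕ => Real.log (((n + 1) ^ k : ℕ) : ℝ) / (n : ℝ)) atTop (𝓝 0) := by
  have h1 : Tendsto (fun n : ℕ => (k : ℝ) * (Real.log ((n : ℝ) + 1) / ((n : ℝ) + 1) *
      (1 + 1 / (n : ℝ)))) atTop (𝓝 (k * (0 * (1 + 0)))) := by
    refine Tendsto.const_mul _ (Tendsto.mul ?_ (tendsto_const_nhds.add
      tendsto_one_div_atTop_nhds_zero_nat))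
    exact Real.isLittleO_log_id_atTop.tendsto_div_nhds_zero.comp
      (tendsto_atTop_add_const_right _ 1 tendsto_natCast_atTop_atTop)
  rw [zero_mul, mul_zero] at h1
  refine h1.congr' ?_
  filter_upwards [eventually_gt_atTop 0] with n hn
  have hn' : (0 : ℝ) < n := by exact_mod_cast hn
  push_cast
  rw [Real.log_pow]
  field_simp

/-- A symmetric sequence of schemes can be replaced by a zero-rate sequence with the same
acceptance regions. -/
lemma exists_zeroRate_of_symScheme [Nonempty X] [Nonempty Y] (T : (n : ℕ) → Scheme X Y n)
    (hT : SymScheme T) : ∃ T' : (n : ℕ) → Scheme X Y n, ZeroRate T' ∧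
      (∀ (P : X × Y → ℝ) n, alphaErr P (T' n) = alphaErr P (T n)) ∧
      ∀ (P : X × Y → ℝ) n, betaErr P (T' n) = betaErr P (T n) := by
  let T' : (n : ℕ) → Scheme X Y n := fun n =>
    { m1 := (n + 1) ^ Fintype.card X
      m2 := (n + 1) ^ Fintype.card Y
      f1 := countCode
      f2 := countCode
      g := fun i j => (T n).g ((T n).f1 (Function.invFun countCode i))
        ((T n).f2 (Function.invFun countCode j)) }
  have hg : ∀ n (x : Fin n → X) (y : Fin n → Y),
      (T' n).g ((T' n).f1 x) ((T' n).f2 y) = (T n).g ((T n).f1 x) ((T n).f2 y) := by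
    intro n x y
    have hx : (T n).f1 (Function.invFun countCode (countCode x)) = (T n).f1 x :=
      (hT n).1 _ _ (empDist_eq_of_countCode_eq (Function.invFun_eq ⟨x, rfl⟩))
    have hy : (T n).f2 (Function.invFun countCode (countCode y)) = (T n).f2 y :=
      (hT n).2 _ _ (empDist_eq_of_countCode_eq (Function.invFun_eq ⟨y, rfl⟩))
    simp only [T', hx, hy]
  refine ⟨T', ⟨tendsto_log_card_countCode _, tendsto_log_card_countCode _⟩, ?_, ?_⟩
  · intro P n
    simp only [alphaErr, hg]
  · intro P n
    simp only [betaErr, hg]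

end Symmetric

section Achievability

/-- A random variable of positive mean has a moment generating function below one somewhere on
the negative axis. -/
lemma exists_sum_mul_exp_neg_lt_one {ι : Type*} [Fintype ι] (p w : ι → ℝ)
    (hp1 : ∑ i, p i = 1) (hw : 0 < ∑ i, p i * w i) :
    ∃ l : ℝ, 0 < l ∧ ∑ i, p i * Real.exp (-(l * w i)) < 1 := by
  have hd : HasDerivAt (fun l : ℝ => ∑ i, p i * Real.exp (-(l * w i)))
      (∑ i, p i * (Real.exp (-(0 * w i)) * -(1 * w i))) 0 :=
    HasDerivAt.fun_sum fun i _ =>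
      (((hasDerivAt_id' (0 : ℝ)).mul_const (w i)).neg.exp).const_mul (p i)
  have hneg : (∑ i, p i * (Real.exp (-(0 * w i)) * -(1 * w i))) < 0 := by
    simpa using hw
  have hev := hd.hasDerivWithinAt (s := Set.Ioi 0) |>.limsup_slope_le' (by simp) hneg
  obtain ⟨l, hl, hl0⟩ := (hev.and self_mem_nhdsWithin).exists
  refine ⟨l, hl0, ?_⟩
  have hl0' : (0 : ℝ) < l := hl0
  rw [slope_def_field, div_lt_iff₀ (by linarith)] at hl
  simp [hp1] at hl
  linarith

/-- The weak law of large numbers, one-sided. -/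
lemma tendsto_prodProb_sum_le (P w : X × Y → ℝ) (hP : IsPos P) (hw : 0 < ∑ z, P z * w z) :
    Tendsto (fun n : ℕ => prodProb P n
      {z : (Fin n → X) × (Fin n → Y) | ∑ i, w (z.1 i, z.2 i) ≤ 0}) atTop (𝓝 0) := by
  obtain ⟨l, hl, h⟩ := exists_sum_mul_exp_neg_lt_one P w hP.2 hw
  refine squeeze_zero (fun n => prodProb_nonneg P (fun z => (hP.1 z).le) n _)
    (fun n => prodProb_le_pow P (fun z => -(l * w z)) (fun z => (hP.1 z).le) _ fun z hz => ?_)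
    (tendsto_pow_atTop_nhds_zero_of_lt_one (Finset.sum_nonneg fun z _ =>
      mul_nonneg (hP.1 z).le (Real.exp_pos _).le) h)
  rw [Finset.sum_neg_distrib, ← Finset.mul_sum]
  have : ∑ i, w (z.1 i, z.2 i) ≤ 0 := hz
  nlinarith

/-- Thresholding empirical means of a function of each coordinate. -/
def thresholdScheme (a : X → ℝ) (b : Y → ℝ) (r t : ℝ) (n : ℕ) : Scheme X Y n where
  m1 := 2
  m2 := 2
  f1 x := if r < ∑ c, a c * empDist x c then 1 else 0
  f2 y := if t < ∑ c, b c * empDist y c then 1 else 0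
  g i j := decide (i = 1 ∧ j = 1)

lemma thresholdScheme_accept_iff (a : X → ℝ) (b : Y → ℝ) (r t : ℝ) {n : ℕ} (hn : 0 < n)
    (x : Fin n → X) (y : Fin n → Y) :
    (thresholdScheme a b r t n).g ((thresholdScheme a b r t n).f1 x)
      ((thresholdScheme a b r t n).f2 y) = true ↔
      0 < ∑ i, (a (x i) - r) ∧ 0 < ∑ i, (b (y i) - t) := by
  have hn' : (0 : ℝ) < n := by exact_mod_cast hn
  simp only [Finset.sum_sub_distrib, sum_eq_mul_sum_empDist hn, Finset.sum_const,
    Finset.card_univ, Fintype.card_fin, nsmul_eq_mul, ← mul_sub, mul_pos_iff_of_pos_left hn',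
    sub_pos]
  simp only [thresholdScheme, decide_eq_true_eq]
  split_ifs with h1 h2 h2 <;> simp [h1, h2]

lemma exists_symScheme_exponent [Nonempty X] [Nonempty Y] (P Q : X × Y → ℝ) (hP : IsPos P)
    (hQ : IsPos Q) {ε : ℝ} (hε : 0 < ε) :
    ∃ T : (n : ℕ) → Scheme X Y n, SymScheme T ∧
      Tendsto (fun n : ℕ => alphaErr P (T n)) atTop (𝓝 0) ∧
      ∀ᶠ n : ℕ in atTop, 0 < betaErr Q (T n) →
        projE P Q - ε ≤ -(1 / (n : ℝ)) * Real.log (betaErr Q (T n)) := by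
  obtain ⟨a, b, hX, hY⟩ := exists_scaling_marginals P Q hP.1 hQ.1
  set R : X × Y → ℝ := fun z => Q z * Real.exp (a z.1 + b z.2) with hR
  have hR0 : ∀ z, 0 < R z := fun z => mul_pos (hQ.1 z) (Real.exp_pos _)
  have hR1 : ∑ z, R z = 1 := by
    rw [← hP.2, Fintype.sum_prod_type, Fintype.sum_prod_type]
    exact Finset.sum_congr rfl fun x _ => congrFun hX x
  set ra := ∑ x, margX P x * a x with hra
  set rb := ∑ y, margY P y * b y with hrb
  have hent : relEnt R Q = ra + rb := by
    have : ∀ z, R z * Real.log (R z / Q z) = R z * a z.1 + R z * b z.2 := by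
      intro z
      rw [hR]
      simp only
      rw [mul_div_cancel_left₀ _ (hQ.1 z).ne', Real.log_exp]
      ring
    rw [relEnt]
    simp_rw [this]
    rw [Finset.sum_add_distrib, sum_mul_fst R a, sum_mul_snd R b, hX, hY]
  have hproj : projE P Q ≤ ra + rb := by
    rw [← hent]
    refine csInf_le ⟨0, ?_⟩ ⟨R, ⟨fun z => (hR0 z).le, hR1⟩, hX, hY, rfl⟩
    rintro d ⟨P', hP', -, -, rfl⟩
    have h1 := exp_sum_mul_log_le P' Q hP'.1 hP'.2 hQ.1
    rw [hQ.2, Real.exp_le_one_iff] at h1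
    have h2 : relEnt P' Q = -∑ z, P' z * Real.log (Q z / P' z) := by
      rw [relEnt, ← Finset.sum_neg_distrib]
      refine Finset.sum_congr rfl fun z _ => ?_
      rw [← inv_div, Real.log_inv]
      ring
    linarith
  have hmean : ∀ w : X × Y → ℝ, ∀ r, ∑ z, P z * w z = r →
      ∑ z, P z * (w z - (r - ε / 2)) = ε / 2 := by
    intro w r hr
    simp_rw [mul_sub (P _) (w _)]
    rw [Finset.sum_sub_distrib, ← Finset.sum_mul, hP.2, hr]
    ring
  have ha := tendsto_prodProb_sum_le P (fun z => a z.1 - (ra - ε / 2)) hP (by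
    rw [hmean (fun z => a z.1) ra (sum_mul_fst P a)]; linarith)
  have hb := tendsto_prodProb_sum_le P (fun z => b z.2 - (rb - ε / 2)) hP (by
    rw [hmean (fun z => b z.2) rb (sum_mul_snd P b)]; linarith)
  have hP0 : ∀ z, 0 ≤ P z := fun z => (hP.1 z).le
  refine ⟨thresholdScheme a b (ra - ε / 2) (rb - ε / 2), fun n => ⟨fun x x' h => ?_,
    fun y y' h => ?_⟩, ?_, ?_⟩
  · simp only [thresholdScheme, h]
  · simp only [thresholdScheme, h]
  · have hab := ha.add hb
    rw [add_zero] at hab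
    refine squeeze_zero' (Eventually.of_forall fun n => prodProb_nonneg P hP0 n _) ?_ hab
    filter_upwards [eventually_gt_atTop 0] with n hn
    refine le_trans (prodProb_mono P hP0 fun z hz => ?_) (prodProb_union_le P hP0 _ _)
    have hz' := (thresholdScheme_accept_iff a b (ra - ε / 2) (rb - ε / 2) hn z.1 z.2).not.mp
      (by rw [hz.out]; simp)
    rw [not_and_or, not_lt, not_lt] at hz'
    exact hz'
  · filter_upwards [eventually_gt_atTop 0] with n hn hpos
    have hn' : (0 : ℝ) < n := by exact_mod_cast hn
    have hle : betaErr Q (thresholdScheme a b (ra - ε / 2) (rb - ε / 2) n)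
        ≤ (Real.exp (-(ra + rb - ε))) ^ n := by
      refine le_trans (prodProb_le_pow Q
        (fun z => (a z.1 - (ra - ε / 2)) + (b z.2 - (rb - ε / 2))) (fun z => (hQ.1 z).le) _
        fun z hz => ?_) (le_of_eq ?_)
      · have := (thresholdScheme_accept_iff a b (ra - ε / 2) (rb - ε / 2) hn z.1 z.2).mp hz
        rw [Finset.sum_add_distrib]
        linarith
      · congr 1
        have : ∀ z : X × Y, Q z * Real.exp ((a z.1 - (ra - ε / 2)) + (b z.2 - (rb - ε / 2)))
            = R z * Real.exp (-(ra + rb - ε)) := by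
          intro z
          rw [hR]
          simp only
          rw [mul_assoc, ← Real.exp_add]
          congr 2
          ring
        simp_rw [this]
        rw [← Finset.sum_mul, hR1, one_mul]
    have hlog := Real.log_le_log hpos hle
    rw [Real.log_pow, Real.log_exp] at hlog
    rw [neg_mul, one_div_mul_eq_div, le_neg, div_le_iff₀ hn']
    nlinarith

/-- A vanishing type I error forces the type II error to be positive. -/
lemma eventually_betaErr_pos (P Q : X × Y → ℝ) (hP : IsPos P) (hQ : IsPos Q)
    (T : (n : ℕ) → Scheme X Y n)
    (hα : Tendsto (fun n : ℕ => alphaErr P (T n)) atTop (𝓝 0)) :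
    ∀ᶠ n : ℕ in atTop, 0 < betaErr Q (T n) := by
  filter_upwards [hα.eventually (gt_mem_nhds one_pos)] with n hn
  rw [alphaErr_eq P hP] at hn
  have hβ : 0 < betaErr P (T n) := by linarith
  obtain ⟨z, -, hz⟩ := Finset.exists_ne_zero_of_sum_ne_zero hβ.ne'
  have hzA : z ∈ {z : (Fin n → X) × (Fin n → Y) |
      (T n).g ((T n).f1 z.1) ((T n).f2 z.2) = true} := by
    by_contra h
    exact hz (if_neg h)
  refine Finset.sum_pos' (fun w _ => ?_) ⟨z, Finset.mem_univ _, ?_⟩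
  · split_ifs
    · exact Finset.prod_nonneg fun i _ => (hQ.1 _).le
    · exact le_rfl
  · rw [if_pos hzA]
    exact Finset.prod_pos fun i _ => hQ.1 _

end Achievability

/-- the optimal type II exponents for zero-rate schemes and for
symmetric schemes both equal the projected relative entropy. -/
theorem zero_rate_and_symmetric_exponent
    [Nonempty X] [Nonempty Y]
    (P Q : X × Y → ℝ) (hP : IsPos P) (hQ : IsPos Q) :
    sSup { e : ℝ | ∃ T : (n : ℕ) → Scheme X Y n, ZeroRate T ∧
        Filter.Tendsto (fun n : ℕ => alphaErr P (T n)) Filter.atTop (nhds 0) ∧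
        e = Filter.liminf
          (fun n : ℕ => -(1 / (n : ℝ)) * Real.log (betaErr Q (T n))) Filter.atTop }
      = sSup { e : ℝ | ∃ T : (n : ℕ) → Scheme X Y n, SymScheme T ∧
        Filter.Tendsto (fun n : ℕ => alphaErr P (T n)) Filter.atTop (nhds 0) ∧
        e = Filter.liminf
          (fun n : ℕ => -(1 / (n : ℝ)) * Real.log (betaErr Q (T n))) Filter.atTop } ∧
    sSup { e : ℝ | ∃ T : (n : ℕ) → Scheme X Y n, SymScheme T ∧
        Filter.Tendsto (fun n : ℕ => alphaErr P (T n)) Filter.atTop (nhds 0) ∧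
        e = Filter.liminf
          (fun n : ℕ => -(1 / (n : ℝ)) * Real.log (betaErr Q (T n))) Filter.atTop }
      = projE P Q := by
  have hne : ∃ d, d ∈ { d : ℝ | ∃ P' : X × Y → ℝ,
      IsDist P' ∧ margX P' = margX P ∧ margY P' = margY P ∧ d = relEnt P' Q } :=
    ⟨_, P, ⟨fun z => (hP.1 z).le, hP.2⟩, rfl, rfl, rfl⟩
  have hPd : IsDist P := ⟨fun z => (hP.1 z).le, hP.2⟩
  have hupper : ∀ T : (n : ℕ) → Scheme X Y n, ZeroRate T →
      Tendsto (fun n : ℕ => alphaErr P (T n)) atTop (𝓝 0) →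
      liminf (fun n : ℕ => -(1 / (n : ℝ)) * Real.log (betaErr Q (T n))) atTop ≤ projE P Q := by
    intro T hT hα
    refine le_csInf hne ?_
    rintro d ⟨P', hP', hX, hY, rfl⟩
    exact liminf_neg_log_betaErr_le P Q P' hP hQ hP' hX hY T hT hα
  set S0 := { e : ℝ | ∃ T : (n : ℕ) → Scheme X Y n, ZeroRate T ∧
        Filter.Tendsto (fun n : ℕ => alphaErr P (T n)) Filter.atTop (nhds 0) ∧
        e = Filter.liminf
          (fun n : ℕ => -(1 / (n : ℝ)) * Real.log (betaErr Q (T n))) Filter.atTop } with hS0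
  set S1 := { e : ℝ | ∃ T : (n : ℕ) → Scheme X Y n, SymScheme T ∧
        Filter.Tendsto (fun n : ℕ => alphaErr P (T n)) Filter.atTop (nhds 0) ∧
        e = Filter.liminf
          (fun n : ℕ => -(1 / (n : ℝ)) * Real.log (betaErr Q (T n))) Filter.atTop } with hS1
  have hsub : S1 ⊆ S0 := by
    rintro e ⟨T, hT, hα, rfl⟩
    obtain ⟨T', hT', h1, h2⟩ := exists_zeroRate_of_symScheme T hT
    exact ⟨T', hT', by simpa only [h1] using hα, by simp only [h2]⟩
  have hle : ∀ e ∈ S0, e ≤ projE P Q := by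
    rintro e ⟨T, hT, hα, rfl⟩
    exact hupper T hT hα
  have hex : ∀ ε > 0, ∃ e ∈ S1, projE P Q - ε ≤ e := by
    intro ε hε
    obtain ⟨T, hT, hα, hT'⟩ := exists_symScheme_exponent P Q hP hQ hε
    refine ⟨_, ⟨T, hT, hα, rfl⟩, ?_⟩
    obtain ⟨T', hZ, h1, h2⟩ := exists_zeroRate_of_symScheme T hT
    have hbd := eventually_neg_log_betaErr_le P Q P hP hQ hPd rfl rfl T' hZ
      (by simpa only [h1] using hα) one_pos
    simp only [h2] at hbd
    refine le_liminf_of_le (IsBoundedUnder.isCoboundedUnder_ge ⟨_, hbd⟩) ?_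
    filter_upwards [hT', eventually_betaErr_pos P Q hP hQ T hα] with n hn hpos
    exact hn hpos
  have hlub1 : IsLUB S1 (projE P Q) := by
    refine ⟨fun e he => hle e (hsub he), fun u hu => le_of_forall_pos_le_add fun ε hε => ?_⟩
    obtain ⟨e, he, h⟩ := hex ε hε
    linarith [hu he]
  have hlub0 : IsLUB S0 (projE P Q) :=
    ⟨fun e he => hle e he, fun u hu => hlub1.2 fun e he => hu (hsub he)⟩
  obtain ⟨e, he, -⟩ := hex 1 one_pos
  have h1 := hlub1.csSup_eq ⟨e, he⟩
  exact ⟨(hlub0.csSup_eq ⟨e, hsub he⟩).trans h1.symm, h1⟩
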